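/- (Problems on a semiaxis) Let K be a monotone kernel function, n ∈ ℕ, r₁,…,rₙ > 0 with R := r₁ + … + rₙ, and let J⁺ be an n-field function on [0,∞) that is R-admissible for K. Then M(S^{[0,∞)}) = m(S^{[0,∞)}), and there exists a point w ∈ S^{[0,∞)} such that m̄⁺(w) = M(S^{[0,∞)}); moreover, if e ∈ S^{[0,∞)} is an equioscillation point on [0,∞), then M(S^{[0,∞)}) = m̄⁺(e) = m̲⁺(e) = m(S^{[0,∞)}). -/

import Mathlib

open Filter Set Topology

noncomputable section

/-- A kernel function: finite on `ℝ \ {0}`, concave on `(-∞,0)` and `(0,∞)`,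
with equal one-sided limits at `0`, equal to `K 0` (real or `⊥`). -/
def IsKernel (K : ℝ → EReal) : Prop :=
  (∀ t : ℝ, t ≠ 0 → K t ≠ ⊥ ∧ K t ≠ ⊤) ∧
  ConcaveOn ℝ (Iio (0:ℝ)) (fun t => (K t).toReal) ∧
  ConcaveOn ℝ (Ioi (0:ℝ)) (fun t => (K t).toReal) ∧
  K 0 ≠ ⊤ ∧
  Tendsto K (𝓝[<] (0:ℝ)) (𝓝 (K 0)) ∧
  Tendsto K (𝓝[>] (0:ℝ)) (𝓝 (K 0))

/-- A monotone kernel: nonincreasing on `(-∞,0)`, nondecreasing on `(0,∞)`. -/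
def MonotoneKernel (K : ℝ → EReal) : Prop :=
  IsKernel K ∧ AntitoneOn K (Iio (0:ℝ)) ∧ MonotoneOn K (Ioi (0:ℝ))

/-- An `n`-field function on `ℝ`: bounded above, finite at more than `n` points. -/
def IsFieldFn (n : ℕ) (J : ℝ → EReal) : Prop :=
  (∃ c : ℝ, ∀ t, J t ≤ (c : EReal)) ∧
  (∃ S : Finset ℝ, n < S.card ∧ ∀ x ∈ S, J x ≠ ⊥)

/-- `J` is `R`-admissible for `K`: `J(t) + R·K(t) → -∞` as `|t| → ∞`. -/
def IsAdmissible (K J : ℝ → EReal) (R : ℝ) : Prop :=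
  Tendsto (fun t => J t + (R : EReal) * K t) (cocompact ℝ) (𝓝 ⊥)

/-- The sum of translates function `F(y,t) = J(t) + ∑ rⱼ K(t - yⱼ)`. -/
def SumTrans (K J : ℝ → EReal) {n : ℕ} (r y : Fin n → ℝ) (t : ℝ) : EReal :=
  J t + ∑ j, (r j : EReal) * K (t - y j)

/-- For monotone `y`, `cell y j` is `[y_j, y_{j+1}]` (with `y_0 = -∞`, `y_{n+1} = ∞`). -/
def cell {n : ℕ} (y : Fin n → ℝ) (j : Fin (n+1)) : Set ℝ :=
  {t | (∀ i : Fin n, (i : ℕ) < (j : ℕ) → y i ≤ t) ∧ (∀ i : Fin n, (j : ℕ) ≤ (i : ℕ) → t ≤ y i)}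

/-- The local maximum `mⱼ(y)` over the `j`-th cell. -/
def mloc (K J : ℝ → EReal) {n : ℕ} (r y : Fin n → ℝ) (j : Fin (n+1)) : EReal :=
  sSup (SumTrans K J r y '' cell y j)

/-- The local maximum `mⱼ^b(y)` over the `j`-th cell intersected with `[-b,b]`. -/
def mlocSeg (K J : ℝ → EReal) {n : ℕ} (r y : Fin n → ℝ) (b : ℝ) (j : Fin (n+1)) : EReal :=
  sSup (SumTrans K J r y '' (cell y j ∩ Icc (-b) b))

/-- `q` has the Mhaskar–Rakhmanov–Saff property for `(K, J, R)` (with `n` nodes). -/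
def HasMRS (K J : ℝ → EReal) (R : ℝ) (n : ℕ) (q : ℝ) : Prop :=
  ∀ r : Fin n → ℝ, (∀ j, 0 < r j) → (∑ j, r j) ≤ R →
    ∀ y : Fin n → ℝ, Monotone y →
      sSup (range (SumTrans K J r y)) = sSup (SumTrans K J r y '' Icc (-q) q)
/-- An `n`-field function on `[0,∞)`: bounded above on `[0,∞)` and finite at more than
`n` points of `[0,∞)`. -/
def IsFieldFnHalf (n : ℕ) (J : ℝ → EReal) : Prop :=
  (∃ c : ℝ, ∀ t ∈ Ici (0 : ℝ), J t ≤ (c : EReal)) ∧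
  (∃ S : Finset ℝ, n < S.card ∧ ∀ x ∈ S, 0 ≤ x ∧ J x ≠ ⊥)

/-- `R`-admissibility on the semiaxis: `J(t) + R·K(t) → -∞` as `t → ∞`. -/
def IsAdmissibleHalf (K J : ℝ → EReal) (R : ℝ) : Prop :=
  Tendsto (fun t => J t + (R : EReal) * K t) atTop (𝓝 ⊥)

/-- The local maximum `mⱼ⁺(y)` on the `j`-th cell of `[0,∞)` determined by the nodes. -/
def mlocHalf (K J : ℝ → EReal) {n : ℕ} (r y : Fin n → ℝ) (j : Fin (n + 1)) : EReal :=
  sSup (SumTrans K J r y '' (cell y j ∩ Ici (0 : ℝ)))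

/-- `f` has a nonnegative nonincreasing supergradient on `(0,∞)`. -/
def HasSupergradient (f : ℝ → ℝ) : Prop :=
  ∃ c : ℝ → ℝ, AntitoneOn c (Ioi 0) ∧
    ∀ a, 0 < a → 0 ≤ c a ∧ ∀ z, 0 < z → f z - f a ≤ c a * (z - a)

theorem hasSupergradient_of_concaveOn {f : ℝ → ℝ} (hf : ConcaveOn ℝ (Ioi 0) f)
    (hmono : MonotoneOn f (Ioi 0)) : HasSupergradient f := by
  have hg : ConvexOn ℝ (Ioi 0) (-f) := hf.neg
  have key : ∀ a, 0 < a → ∀ z, 0 < z →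
      f z - f a ≤ -derivWithin (-f) (Ioi a) a * (z - a) := by
    intro a ha z hz
    have hai : a ∈ interior (Ioi (0 : ℝ)) := by rwa [interior_Ioi]
    rcases lt_trichotomy a z with h | h | h
    · have h1 := hg.rightDeriv_le_slope_of_mem_interior hai hz h
      rw [slope_def_field, le_div_iff₀ (sub_pos.2 h)] at h1
      simp only [Pi.neg_apply] at h1
      linarith
    · simp [h]
    · have h1 := (hg.slope_le_leftDeriv_of_mem_interior hz hai h).trans
        (hg.leftDeriv_le_rightDeriv_of_mem_interior hai)
      rw [slope_def_field, div_le_iff₀ (sub_pos.2 h)] at h1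
      simp only [Pi.neg_apply] at h1
      linarith
  refine ⟨fun a => -derivWithin (-f) (Ioi a) a, ?_, fun a ha => ⟨?_, key a ha⟩⟩
  · intro a ha b hb hab
    rcases hab.eq_or_lt with rfl | h
    · exact le_rfl
    · have h1 := key a ha b hb
      have h2 := key b hb a ha
      have : 0 < b - a := sub_pos.2 h
      dsimp only
      nlinarith
  · have h1 := key a ha (a + 1) (by linarith)
    have h2 := hmono (mem_Ioi.2 ha) (mem_Ioi.2 (by linarith : 0 < a + 1)) (by linarith)
    dsimp only
    linarith

/-- A continuous kernel with values in `[-∞,∞)`, finite off the origin, increasing away from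
the origin with supergradients on both sides. -/
structure RegularKernel (K : ℝ → EReal) : Prop where
  continuous : Continuous K
  ne_top : ∀ x, K x ≠ ⊤
  ne_bot : ∀ x, x ≠ 0 → K x ≠ ⊥
  right : HasSupergradient fun z => (K z).toReal
  left : HasSupergradient fun z => (K (-z)).toReal

theorem RegularKernel.coe_toReal {K : ℝ → EReal} (hK : RegularKernel K) {x : ℝ} (hx : x ≠ 0) :
    ((K x).toReal : EReal) = K x :=
  EReal.coe_toReal (hK.ne_top x) (hK.ne_bot x hx)

theorem MonotoneKernel.regularKernel {K : ℝ → EReal} (hK : MonotoneKernel K) :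
    RegularKernel K := by
  obtain ⟨⟨hfin, hcl, hcr, h0, htl, htr⟩, hanti, hmono⟩ := hK
  have hrm : MonotoneOn (fun z => (K z).toReal) (Ioi 0) := fun a ha b hb hab =>
    EReal.toReal_le_toReal (hmono ha hb hab) (hfin a ha.ne').1 (hfin b hb.ne').2
  have hlm : MonotoneOn (fun z => (K (-z)).toReal) (Ioi 0) := by
    intro a ha b hb hab
    have ha' : (0 : ℝ) < a := ha
    have hb' : (0 : ℝ) < b := hb
    exact EReal.toReal_le_toReal (hanti (mem_Iio.2 (by linarith)) (mem_Iio.2 (by linarith))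
      (neg_le_neg hab)) (hfin _ (by linarith)).1 (hfin _ (by linarith)).2
  have hlc : ConcaveOn ℝ (Ioi 0) (fun z => (K (-z)).toReal) := by
    refine ⟨convex_Ioi 0, fun a ha b hb s t hs ht hst => ?_⟩
    have ha' : -a ∈ Iio (0 : ℝ) := by simpa using ha
    have hb' : -b ∈ Iio (0 : ℝ) := by simpa using hb
    have := hcl.2 ha' hb' hs ht hst
    simp only [smul_eq_mul] at this ⊢
    rwa [show -(s * a + t * b) = s * -a + t * -b by ring]
  refine ⟨?_, ?_, fun x hx => (hfin x hx).1, hasSupergradient_of_concaveOn hcr hrm,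
    hasSupergradient_of_concaveOn hlc hlm⟩
  · rw [continuous_iff_continuousAt]
    intro x
    have hoff : ∀ s : Set ℝ, IsOpen s → x ∈ s → (0 : ℝ) ∉ s →
        ConcaveOn ℝ s (fun t => (K t).toReal) → ContinuousAt K x := by
      intro s hs hx hs0 hc
      have h1 := (hc.continuousOn hs).continuousAt (hs.mem_nhds hx)
      refine (continuous_coe_real_ereal.continuousAt.comp h1).congr ?_
      filter_upwards [hs.mem_nhds hx] with t ht
      have : t ≠ 0 := fun h => hs0 (h ▸ ht)
      exact EReal.coe_toReal (hfin t this).2 (hfin t this).1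
    rcases lt_trichotomy x 0 with h | h | h
    · exact hoff _ isOpen_Iio h self_notMem_Iio hcl
    · subst h
      rw [continuousAt_iff_punctured_nhds, ← Iio_union_Ioi, nhdsWithin_union]
      exact htl.sup htr
    · exact hoff _ isOpen_Ioi h self_notMem_Ioi hcr
  · intro x
    rcases eq_or_ne x 0 with rfl | h
    · exact h0
    · exact (hfin x h).2

theorem EReal.coe_mul_ne_top {a : ℝ} (ha : 0 < a) {x : EReal} (hx : x ≠ ⊤) :
    (a : EReal) * x ≠ ⊤ := by
  induction x using EReal.rec with
  | bot => simp [EReal.coe_mul_bot_of_pos ha]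
  | coe x => rw [← EReal.coe_mul]; exact EReal.coe_ne_top _
  | top => exact absurd rfl hx

theorem EReal.coe_mul_ne_bot {a : ℝ} (ha : 0 < a) {x : EReal} :
    (a : EReal) * x ≠ ⊥ ↔ x ≠ ⊥ := by
  induction x using EReal.rec with
  | bot => simp [EReal.coe_mul_bot_of_pos ha]
  | coe x => rw [← EReal.coe_mul]; simp [-EReal.coe_mul]
  | top => simp [EReal.coe_mul_top_of_pos ha]

theorem EReal.continuous_add_of_ne_top {X : Type*} [TopologicalSpace X] {f g : X → EReal}
    (hf : Continuous f) (hg : Continuous g) (hft : ∀ x, f x ≠ ⊤) (hgt : ∀ x, g x ≠ ⊤) :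
    Continuous fun x => f x + g x :=
  continuous_iff_continuousAt.2 fun _ =>
    ContinuousAt.comp (f := fun x => (f x, g x))
      (EReal.continuousAt_add (Or.inl (hft _)) (Or.inr (hgt _)))
      (hf.prodMk hg).continuousAt

theorem EReal.sum_ne_top {ι : Type*} (s : Finset ι) {f : ι → EReal} (h : ∀ i, f i ≠ ⊤) :
    ∑ i ∈ s, f i ≠ ⊤ := by
  classical
  induction s using Finset.induction_on with
  | empty => simp
  | insert a s ha ih => rw [Finset.sum_insert ha]; exact EReal.add_ne_top (h a) ih

theorem EReal.sum_ne_bot {ι : Type*} (s : Finset ι) {f : ι → EReal} :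
    ∑ i ∈ s, f i ≠ ⊥ ↔ ∀ i ∈ s, f i ≠ ⊥ := by
  classical
  induction s using Finset.induction_on with
  | empty => simp
  | insert a s ha ih => rw [Finset.sum_insert ha, EReal.add_ne_bot_iff, ih]; simp

theorem EReal.continuous_sum_of_ne_top {ι X : Type*} [TopologicalSpace X] (s : Finset ι)
    {f : ι → X → EReal} (hf : ∀ i, Continuous (f i)) (ht : ∀ i a, f i a ≠ ⊤) :
    Continuous fun x => ∑ i ∈ s, f i x := by
  classical
  induction s using Finset.induction_on with
  | empty => simpa using continuous_const
  | insert a s ha ih =>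
    simp only [Finset.sum_insert ha]
    exact EReal.continuous_add_of_ne_top (hf a) ih (ht a) fun b => sum_ne_top s fun i => ht i b

theorem EReal.coe_sum {ι : Type*} (s : Finset ι) (f : ι → ℝ) :
    ((∑ i ∈ s, f i : ℝ) : EReal) = ∑ i ∈ s, (f i : EReal) := by
  classical
  induction s using Finset.induction_on with
  | empty => simp
  | insert a s ha ih => rw [Finset.sum_insert ha, Finset.sum_insert ha, EReal.coe_add, ih]

theorem RegularKernel.continuous_coe_mul {K : ℝ → EReal} (hK : RegularKernel K) (a : ℝ) :
    Continuous fun x => (a : EReal) * K x :=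
  continuous_iff_continuousAt.2 fun _ =>
    EReal.Tendsto.const_mul hK.continuous.continuousAt (Or.inl (EReal.coe_ne_bot _))
      (Or.inl (EReal.coe_ne_top _))

section Translates

variable {K J : ℝ → EReal} {n : ℕ} {r : Fin n → ℝ}

theorem RegularKernel.continuous_sum (hK : RegularKernel K) (hr : ∀ j, 0 < r j)
    {X : Type*} [TopologicalSpace X] {g : Fin n → X → ℝ}
    (hg : ∀ i, Continuous (g i)) :
    Continuous fun x => ∑ j, (r j : EReal) * K (g j x) :=
  EReal.continuous_sum_of_ne_top _ (fun i => (hK.continuous_coe_mul (r i)).comp (hg i))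
    fun i _ => EReal.coe_mul_ne_top (hr i) (hK.ne_top _)

theorem RegularKernel.sum_ne_top (hK : RegularKernel K) (hr : ∀ j, 0 < r j) (g : Fin n → ℝ) :
    ∑ j, (r j : EReal) * K (g j) ≠ ⊤ :=
  EReal.sum_ne_top _ fun i => EReal.coe_mul_ne_top (hr i) (hK.ne_top _)

theorem RegularKernel.continuous_sumTrans (hK : RegularKernel K) (hr : ∀ j, 0 < r j) {t : ℝ}
    (hJ : J t ≠ ⊤) : Continuous fun y : Fin n → ℝ => SumTrans K J r y t :=
  EReal.continuous_add_of_ne_top continuous_const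
    (hK.continuous_sum hr fun i => continuous_const.sub (continuous_apply i)) (fun _ => hJ)
    fun _ => hK.sum_ne_top hr _

/-- Summation by parts: if the partial sums of `u` are maximal at `k` and `g` is nonincreasing
except for a jump from nonpositive to nonnegative values at `k`, then `∑ g i * u i ≤ 0`. -/
theorem sum_mul_nonpos_of_partial_sum_le {g u : ℕ → ℝ} {N k : ℕ} (hk : k ≤ N)
    (hW : ∀ m ≤ N, ∑ i ∈ Finset.range m, u i ≤ ∑ i ∈ Finset.range k, u i)
    (hg : ∀ m < N, m + 1 ≠ k → g (m + 1) ≤ g m) (h0 : k ≠ 0 → g 0 ≤ 0) (hN : g N = 0) :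
    ∑ i ∈ Finset.range N, g i * u i ≤ 0 := by
  set W : ℕ → ℝ := fun m => ∑ i ∈ Finset.range m, u i - ∑ i ∈ Finset.range k, u i with hWdef
  have hWk : W k = 0 := sub_self _
  have hW' : ∀ m ≤ N, W m ≤ 0 := fun m hm => sub_nonpos.2 (hW m hm)
  have key : ∀ m ≤ N, ∑ i ∈ Finset.range m, g i * u i ≤ g m * W m := by
    intro m
    induction m with
    | zero =>
      intro _
      rcases eq_or_ne k 0 with h | h
      · subst h; simp [hWk]
      · simpa using mul_nonneg_of_nonpos_of_nonpos (h0 h) (hW' 0 (Nat.zero_le _))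
    | succ m ih =>
      intro hm
      have h1 := ih (by omega)
      have h2 : W (m + 1) = W m + u m := by simp only [hWdef, Finset.sum_range_succ]; ring
      rw [Finset.sum_range_succ]
      have h3 : g m * W (m + 1) ≤ g (m + 1) * W (m + 1) := by
        rcases eq_or_ne (m + 1) k with h | h
        · rw [h, hWk]; simp
        · exact mul_le_mul_of_nonpos_right (hg m (by omega) h) (hW' _ hm)
      rw [h2, mul_add] at h3
      rw [h2]
      linarith
  simpa [hN] using key N le_rfl

/-- Two node systems are always comparable on some cell of the first one. -/
theorem RegularKernel.exists_cell_sumTrans_le (hK : RegularKernel K) (hr : ∀ j, 0 < r j)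
    {x y : Fin n → ℝ} (hy : Monotone y) :
    ∃ k : Fin (n + 1), ∀ t ∈ cell x k,
      t ∈ cell y k ∧ SumTrans K J r x t ≤ SumTrans K J r y t := by
  let u : ℕ → ℝ := fun i => if h : i < n then r ⟨i, h⟩ * (x ⟨i, h⟩ - y ⟨i, h⟩) else 0
  obtain ⟨k, hkn, hkmax⟩ := Finset.exists_max_image (Finset.range (n + 1))
    (fun m => ∑ i ∈ Finset.range m, u i) ⟨0, by simp⟩
  have hk : k ≤ n := by simpa [Nat.lt_succ_iff] using hkn
  have hW : ∀ m ≤ n, ∑ i ∈ Finset.range m, u i ≤ ∑ i ∈ Finset.range k, u i :=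
    fun m hm => hkmax m (by simpa [Nat.lt_succ_iff] using hm)
  refine ⟨⟨k, by omega⟩, fun t ht => ?_⟩
  obtain ⟨hleft, hright⟩ := ht
  have hyl : ∀ i : Fin n, (i : ℕ) < k → y i ≤ t := by
    intro i hi
    obtain ⟨m, rfl⟩ : ∃ m, k = m + 1 := ⟨k - 1, by omega⟩
    have h1 := hW m (by omega)
    have hm : m < n := by omega
    rw [Finset.sum_range_succ] at h1
    have h2 : 0 ≤ r ⟨m, hm⟩ * (x ⟨m, hm⟩ - y ⟨m, hm⟩) := by
      have : u m = r ⟨m, hm⟩ * (x ⟨m, hm⟩ - y ⟨m, hm⟩) := dif_pos hm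
      linarith
    have h3 : 0 ≤ x ⟨m, hm⟩ - y ⟨m, hm⟩ := nonneg_of_mul_nonneg_right h2 (hr _)
    have h4 : y i ≤ y ⟨m, hm⟩ := hy (Fin.mk_le_mk.2 (by omega))
    have h5 := hleft ⟨m, hm⟩ (Nat.lt_succ_self m)
    linarith
  have hyr : ∀ i : Fin n, k ≤ (i : ℕ) → t ≤ y i := by
    intro i hi
    have hkn' : k < n := by omega
    have h1 := hW (k + 1) (by omega)
    rw [Finset.sum_range_succ] at h1
    have h2 : 0 ≤ r ⟨k, hkn'⟩ * (y ⟨k, hkn'⟩ - x ⟨k, hkn'⟩) := by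
      have : u k = r ⟨k, hkn'⟩ * (x ⟨k, hkn'⟩ - y ⟨k, hkn'⟩) := dif_pos hkn'
      linarith
    have h3 : 0 ≤ y ⟨k, hkn'⟩ - x ⟨k, hkn'⟩ := nonneg_of_mul_nonneg_right h2 (hr _)
    have h4 : y ⟨k, hkn'⟩ ≤ y i := hy (Fin.mk_le_mk.2 hi)
    have h5 := hright ⟨k, hkn'⟩ le_rfl
    linarith
  refine ⟨⟨hyl, hyr⟩, ?_⟩
  let e : Fin n → ℝ := fun i => if (i : ℕ) < k then 1 else -1
  obtain ⟨cr, hcra, hcr⟩ := hK.right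
  obtain ⟨cl, hcla, hcl⟩ := hK.left
  have hne : ∀ (z : Fin n → ℝ), (∀ i : Fin n, (i : ℕ) < k → z i ≤ t) →
      (∀ i : Fin n, k ≤ (i : ℕ) → t ≤ z i) → ∀ ε > 0, ∀ i, t - z i + e i * ε ≠ 0 := by
    intro z hzl hzr ε hε i
    by_cases hi : (i : ℕ) < k
    · have := hzl i hi
      simp only [e, if_pos hi]
      exact (by linarith : 0 < t - z i + 1 * ε).ne'
    · have := hzr i (not_lt.1 hi)
      simp only [e, if_neg hi]
      exact (by linarith : t - z i + -1 * ε < 0).ne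
  have hreal : ∀ ε > 0, ∑ i, r i * (K (t - x i + e i * ε)).toReal ≤
      ∑ i, r i * (K (t - y i + e i * ε)).toReal := by
    intro ε hε
    let g : ℕ → ℝ := fun i => if h : i < n then
      (if i < k then -cr (t - y ⟨i, h⟩ + ε) else cl (y ⟨i, h⟩ - t + ε)) else 0
    have hgl : ∀ i (h : i < n), i < k → g i = -cr (t - y ⟨i, h⟩ + ε) := by
      intro i h hi; simp [g, h, hi]
    have hgr : ∀ i (h : i < n), k ≤ i → g i = cl (y ⟨i, h⟩ - t + ε) := by
      intro i h hi; simp [g, h, not_lt.2 hi]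
    have hsum : ∑ i ∈ Finset.range n, g i * u i ≤ 0 := by
      refine sum_mul_nonpos_of_partial_sum_le hk hW ?_ ?_ (by simp [g])
      · intro m hm hmk
        by_cases hm1 : m + 1 < n
        · have hyy : y ⟨m, hm⟩ ≤ y ⟨m + 1, hm1⟩ := hy (Fin.mk_le_mk.2 (Nat.le_succ m))
          rcases lt_or_gt_of_ne hmk with h | h
          · have h2 := hyl ⟨m + 1, hm1⟩ h
            rw [hgl m hm (by omega), hgl (m + 1) hm1 h]
            exact neg_le_neg (hcra (mem_Ioi.2 (by linarith)) (mem_Ioi.2 (by linarith))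
              (by linarith))
          · have h2 := hyr ⟨m, hm⟩ (by simp only; omega)
            rw [hgr m hm (by omega), hgr (m + 1) hm1 (by omega)]
            exact hcla (mem_Ioi.2 (by linarith)) (mem_Ioi.2 (by linarith)) (by linarith)
        · have h0 : g (m + 1) = 0 := dif_neg hm1
          have h2 := hyr ⟨m, hm⟩ (by simp only; omega)
          rw [h0, hgr m hm (by omega)]
          exact (hcl _ (by linarith)).1
      · intro hk0
        have h2 := hyl ⟨0, by omega⟩ (Nat.pos_of_ne_zero hk0)
        rw [hgl 0 (by omega) (Nat.pos_of_ne_zero hk0)]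
        exact neg_nonpos.2 (hcr _ (by linarith)).1
    rw [← Fin.sum_univ_eq_sum_range (fun i => g i * u i)] at hsum
    rw [← sub_nonpos, ← Finset.sum_sub_distrib]
    refine (Finset.sum_le_sum fun i _ => ?_).trans hsum
    have hu : u i = r i * (x i - y i) := dif_pos i.2
    rw [hu, ← mul_sub]
    suffices h : (K (t - x i + e i * ε)).toReal - (K (t - y i + e i * ε)).toReal ≤
        g i * (x i - y i) by
      calc _ ≤ r i * (g i * (x i - y i)) := mul_le_mul_of_nonneg_left h (hr i).le
        _ = _ := by ring
    by_cases hi : (i : ℕ) < k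
    · have h1 := hleft i hi
      have h2 := hyl i hi
      have h3 := (hcr (t - y i + ε) (by linarith)).2 (t - x i + ε) (by linarith)
      rw [hgl i i.2 hi]
      simp only [e, if_pos hi, one_mul]
      refine h3.trans (le_of_eq ?_)
      ring
    · have h1 := hright i (not_lt.1 hi)
      have h2 := hyr i (not_lt.1 hi)
      have h3 := (hcl (y i - t + ε) (by linarith)).2 (x i - t + ε) (by linarith)
      rw [hgr i i.2 (not_lt.1 hi)]
      simp only [e, if_neg hi]
      rw [show t - x i + -1 * ε = -(x i - t + ε) by ring,
        show t - y i + -1 * ε = -(y i - t + ε) by ring]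
      refine h3.trans (le_of_eq ?_)
      ring
  have hcoe : ∀ (z : Fin n → ℝ), (∀ i : Fin n, (i : ℕ) < k → z i ≤ t) →
      (∀ i : Fin n, k ≤ (i : ℕ) → t ≤ z i) → ∀ ε > 0,
      ∑ i, (r i : EReal) * K (t - z i + e i * ε) =
        ((∑ i, r i * (K (t - z i + e i * ε)).toReal : ℝ) : EReal) := by
    intro z hzl hzr ε hε
    rw [EReal.coe_sum]
    refine Finset.sum_congr rfl fun i _ => ?_
    rw [EReal.coe_mul, hK.coe_toReal (hne z hzl hzr ε hε i)]
  have hlim : ∀ z : Fin n → ℝ, Tendsto (fun ε : ℝ => ∑ i, (r i : EReal) * K (t - z i + e i * ε))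
      (𝓝[>] 0) (𝓝 (∑ i, (r i : EReal) * K (t - z i))) := by
    intro z
    have hc : Continuous fun ε : ℝ => ∑ i, (r i : EReal) * K (t - z i + e i * ε) :=
      hK.continuous_sum hr fun i => by fun_prop
    have h := hc.tendsto 0
    simp only [mul_zero, add_zero] at h
    exact h.mono_left nhdsWithin_le_nhds
  refine add_le_add_right (le_of_tendsto_of_tendsto (hlim x) (hlim y) ?_) _
  filter_upwards [self_mem_nhdsWithin] with ε hε
  rw [hcoe x hleft hright ε hε, hcoe y hyl hyr ε hε]
  exact EReal.coe_le_coe_iff.2 (hreal ε hε)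

theorem RegularKernel.iInf_mlocHalf_le_iSup (hK : RegularKernel K) (hr : ∀ j, 0 < r j)
    {x y : Fin n → ℝ} (hy : Monotone y) :
    ⨅ j, mlocHalf K J r x j ≤ ⨆ j, mlocHalf K J r y j := by
  obtain ⟨k, hk⟩ := hK.exists_cell_sumTrans_le (J := J) (x := x) hr hy
  refine (iInf_le _ k).trans (le_trans (sSup_le ?_) (le_iSup _ k))
  rintro _ ⟨t, ⟨ht, ht0⟩, rfl⟩
  exact (hk t ht).2.trans (le_sSup ⟨t, ⟨(hk t ht).1, ht0⟩, rfl⟩)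

theorem exists_mem_cell {y : Fin n → ℝ} (hy : Monotone y) (t : ℝ) :
    ∃ j : Fin (n + 1), t ∈ cell y j := by
  let P : ℕ → Prop := fun m => ∀ i : Fin n, (i : ℕ) < m → y i ≤ t
  classical
  have h0 : P 0 := fun i hi => absurd hi (Nat.not_lt_zero _)
  have hP : P (Nat.findGreatest P n) := Nat.findGreatest_spec (Nat.zero_le n) h0
  refine ⟨⟨Nat.findGreatest P n, Nat.lt_succ_of_le (Nat.findGreatest_le n)⟩, hP, ?_⟩
  intro i hi
  by_contra! h
  refine Nat.findGreatest_is_greatest (P := P) (Nat.lt_succ_of_le hi) i.2 fun i' hi' => ?_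
  exact (hy (Fin.le_def.2 (Nat.lt_succ_iff.1 hi'))).trans h.le

theorem sumTrans_le_iSup_mlocHalf {y : Fin n → ℝ} (hy : Monotone y) {t : ℝ} (ht : 0 ≤ t) :
    SumTrans K J r y t ≤ ⨆ j, mlocHalf K J r y j := by
  obtain ⟨j, hj⟩ := exists_mem_cell hy t
  exact (le_sSup (mem_image_of_mem _ (mem_inter hj ht))).trans
    (le_iSup (fun j => mlocHalf K J r y j) j)

theorem iSup_mlocHalf_le {y : Fin n → ℝ} {M : EReal}
    (h : ∀ t, 0 ≤ t → SumTrans K J r y t ≤ M) : ⨆ j, mlocHalf K J r y j ≤ M := by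
  refine iSup_le fun j => sSup_le ?_
  rintro _ ⟨t, ⟨-, ht⟩, rfl⟩
  exact h t ht

theorem sumTrans_le_sumTrans (hr : ∀ j, 0 < r j) {x y : Fin n → ℝ} {t : ℝ}
    (h : ∀ i, K (t - x i) ≤ K (t - y i)) : SumTrans K J r x t ≤ SumTrans K J r y t :=
  add_le_add_right (Finset.sum_le_sum fun i _ =>
    mul_le_mul_of_nonneg_left (h i) (EReal.coe_nonneg.2 (hr i).le)) _

theorem MonotoneKernel.antitoneOn_Iic (hK : MonotoneKernel K) : AntitoneOn K (Iic 0) := by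
  intro a ha b hb hab
  rcases hab.eq_or_lt with rfl | h
  · exact le_rfl
  rcases (mem_Iic.1 hb).eq_or_lt with rfl | hb0
  · refine le_of_tendsto hK.1.2.2.2.2.1 ?_
    filter_upwards [Ioo_mem_nhdsLT h] with s hs
    exact hK.2.1 h hs.2 hs.1.le
  · exact hK.2.1 (h.trans hb0) hb0 hab

theorem MonotoneKernel.sumTrans_le_of_lt (hK : MonotoneKernel K) (hr : ∀ j, 0 < r j)
    {y : Fin n → ℝ} {t : ℝ} (ht : 0 < t) (h0 : ∀ i, 0 ≤ y i) (hy : ∀ i, y i < t) :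
    SumTrans K J r y t ≤ J t + ((∑ j, r j : ℝ) : EReal) * K t := by
  have h1 : SumTrans K J r y t ≤ SumTrans K J r (fun _ => 0) t := by
    refine sumTrans_le_sumTrans hr fun i => ?_
    rw [sub_zero]
    exact hK.2.2 (mem_Ioi.2 (sub_pos.2 (hy i))) ht (by linarith [h0 i])
  refine h1.trans (le_of_eq ?_)
  simp only [SumTrans, sub_zero]
  rw [← hK.regularKernel.coe_toReal ht.ne', ← EReal.coe_mul, Finset.sum_mul, EReal.coe_sum]
  simp only [EReal.coe_mul]

/-- Compact set of node systems in `[0,b]`. -/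
def nodesIn (n : ℕ) (b : ℝ) : Set (Fin n → ℝ) :=
  {y | Monotone y ∧ ∀ j, 0 ≤ y j ∧ y j ≤ b}

theorem isCompact_nodesIn (b : ℝ) : IsCompact (nodesIn n b) := by
  have h : nodesIn n b = {y | Monotone y} ∩ Set.pi univ fun _ => Icc 0 b := by
    ext y
    simp only [nodesIn, mem_ofPred_eq, mem_inter_iff, Set.mem_pi, mem_univ, true_implies, mem_Icc]
  rw [h]
  refine (isCompact_univ_pi fun _ => isCompact_Icc).inter_left ?_
  simp only [Monotone, ofPred_forall]
  exact isClosed_iInter fun i => isClosed_iInter fun j => isClosed_iInter fun _ =>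
    isClosed_le (continuous_apply i) (continuous_apply j)

theorem nodesIn_nonempty {b : ℝ} (hb : 0 ≤ b) : (nodesIn n b).Nonempty :=
  ⟨fun _ => 0, monotone_const, fun _ => ⟨le_rfl, hb⟩⟩

theorem MonotoneKernel.exists_sumTrans_lt (hK : MonotoneKernel K) (hr : ∀ j, 0 < r j)
    (hadm : IsAdmissibleHalf K J (∑ j, r j)) {μ : EReal} (hμ : μ ≠ ⊥) :
    ∃ b : ℝ, 0 ≤ b ∧ ∀ y ∈ nodesIn n b, ∀ t, b < t → SumTrans K J r y t < μ := by
  obtain ⟨b, hb⟩ := eventually_atTop.1 (hadm.eventually (eventually_lt_nhds hμ.bot_lt))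
  refine ⟨max b 0, le_max_right _ _, fun y hy t ht => ?_⟩
  have ht0 : 0 < t := (le_max_right _ _).trans_lt ht
  exact (hK.sumTrans_le_of_lt hr ht0 (fun i => (hy.2 i).1)
    fun i => (hy.2 i).2.trans_lt ht).trans_lt (hb t ((le_max_left _ _).trans ht.le))

theorem MonotoneKernel.exists_iSup_mlocHalf_le (hK : MonotoneKernel K) (hr : ∀ j, 0 < r j)
    (hJ : ∀ t, 0 ≤ t → J t ≠ ⊤) (hadm : IsAdmissibleHalf K J (∑ j, r j)) {μ : EReal}
    (hμ : μ ≠ ⊥)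
    (hle : ∀ y : Fin n → ℝ, Monotone y → (∀ j, 0 ≤ y j) → μ ≤ ⨆ j, mlocHalf K J r y j) :
    ∃ w : Fin n → ℝ, Monotone w ∧ (∀ j, 0 ≤ w j) ∧ ∀ y : Fin n → ℝ, Monotone y →
      (∀ j, 0 ≤ y j) → ⨆ j, mlocHalf K J r w j ≤ ⨆ j, mlocHalf K J r y j := by
  obtain ⟨b, hb0, hb⟩ := hK.exists_sumTrans_lt hr hadm hμ
  have hlsc : LowerSemicontinuous fun y : Fin n → ℝ => ⨆ t : Ici (0 : ℝ), SumTrans K J r y t :=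
    lowerSemicontinuous_iSup fun t =>
      (hK.regularKernel.continuous_sumTrans hr (hJ t t.2)).lowerSemicontinuous
  obtain ⟨w, hw, hmin⟩ := (hlsc.lowerSemicontinuousOn _).exists_isMinOn (nodesIn_nonempty hb0)
    (isCompact_nodesIn (n := n) b)
  refine ⟨w, hw.1, fun j => (hw.2 j).1, fun y hy hy0 => ?_⟩
  let y' : Fin n → ℝ := fun i => min (y i) b
  have hy' : y' ∈ nodesIn n b :=
    ⟨fun i j hij => min_le_min_right b (hy hij), fun i => ⟨le_min (hy0 i) hb0, min_le_right _ _⟩⟩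
  refine iSup_mlocHalf_le fun t ht => ?_
  refine (le_iSup (fun t : Ici (0 : ℝ) => SumTrans K J r w t) ⟨t, ht⟩).trans
    ((isMinOn_iff.1 hmin y' hy').trans (iSup_le ?_))
  rintro ⟨s, hs⟩
  rcases le_or_gt s b with hsb | hsb
  · refine (sumTrans_le_sumTrans hr fun i => ?_).trans (sumTrans_le_iSup_mlocHalf hy hs)
    rcases le_total (y i) b with h | h
    · simp [y', h]
    · simp only [y', min_eq_right h]
      exact hK.antitoneOn_Iic (mem_Iic.2 (by linarith)) (mem_Iic.2 (by linarith)) (by linarith)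
  · exact (hb y' hy' s hsb).le.trans (hle y hy hy0)

theorem RegularKernel.exists_iInf_mlocHalf_ne_bot (hK : RegularKernel K) (hr : ∀ j, 0 < r j)
    (hJ : ∃ S : Finset ℝ, n < S.card ∧ ∀ x ∈ S, 0 ≤ x ∧ J x ≠ ⊥) :
    ∃ y : Fin n → ℝ, Monotone y ∧ (∀ j, 0 ≤ y j) ∧ ⨅ j, mlocHalf K J r y j ≠ ⊥ := by
  obtain ⟨S, hS, hSJ⟩ := hJ
  obtain ⟨T, hTS, hT⟩ := Finset.exists_subset_card_eq (Nat.succ_le_of_lt hS)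
  let s : Fin (n + 1) ↪o ℝ := T.orderEmbOfFin hT
  have hs : ∀ j, 0 ≤ s j ∧ J (s j) ≠ ⊥ := fun j => hSJ _ (hTS (T.orderEmbOfFin_mem hT j))
  have hlt : ∀ i : Fin n, s i.castSucc < s i.succ := fun i => s.strictMono Fin.castSucc_lt_succ
  let y : Fin n → ℝ := fun i => (s i.castSucc + s i.succ) / 2
  have hyl : ∀ (i : Fin n) (j : Fin (n + 1)), (i : ℕ) < j → y i < s j := by
    intro i j hij
    have h1 : s i.succ ≤ s j := s.monotone (Fin.le_def.2 (by simpa using hij))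
    have := hlt i
    simp only [y]
    linarith
  have hyr : ∀ (i : Fin n) (j : Fin (n + 1)), (j : ℕ) ≤ i → s j < y i := by
    intro i j hij
    have h1 : s j ≤ s i.castSucc := s.monotone (Fin.le_def.2 (by simpa using hij))
    have := hlt i
    simp only [y]
    linarith
  refine ⟨y, fun i j hij => ?_, fun i => ?_, ?_⟩
  · have h1 : s i.castSucc ≤ s j.castSucc := s.monotone (Fin.castSucc_le_castSucc_iff.2 hij)
    have h2 : s i.succ ≤ s j.succ := s.monotone (Fin.succ_le_succ_iff.2 hij)
    simp only [y]
    linarith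
  · exact (hs _).1.trans (hyr i i.castSucc le_rfl).le
  · obtain ⟨j, hj⟩ := exists_eq_ciInf_of_finite (f := fun j => mlocHalf K J r y j)
    rw [← hj]
    have hmem : s j ∈ cell y j ∩ Ici 0 :=
      ⟨⟨fun i hi => (hyl i j hi).le, fun i hi => (hyr i j hi).le⟩, (hs j).1⟩
    refine ne_bot_of_le_ne_bot ?_ (le_sSup (mem_image_of_mem _ hmem))
    refine EReal.add_ne_bot_iff.2 ⟨(hs j).2, (EReal.sum_ne_bot _).2 fun i _ =>
      (EReal.coe_mul_ne_bot (hr i)).2 (hK.ne_bot _ ?_)⟩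
    rcases lt_or_ge (i : ℕ) (j : ℕ) with h | h
    · exact (sub_pos.2 (hyl i j h)).ne'
    · exact (sub_neg.2 (hyr i j h)).ne

/-- `f` has a nonnegative nonincreasing supergradient on `(0,∞)` with strict inequalities. -/
def HasStrictSupergradient (f : ℝ → ℝ) : Prop :=
  ∃ c : ℝ → ℝ, AntitoneOn c (Ioi 0) ∧
    ∀ a, 0 < a → 0 ≤ c a ∧ ∀ z, 0 < z → z ≠ a → f z - f a < c a * (z - a)

theorem HasStrictSupergradient.sum_lt {f : ℝ → ℝ} (hf : HasStrictSupergradient f)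
    (hr : ∀ j, 0 < r j) {z v : Fin n → ℝ} {a : ℝ} (ha : 0 < a)
    (hneg : ∀ i, v i < 0 → z i = a ∧ 0 < z i + v i) (hpos : ∀ i, 0 < v i → a ≤ z i)
    (hex : ∃ i, v i < 0) (hsum : ∑ i, r i * v i ≤ 0) :
    ∑ i, r i * f (z i + v i) < ∑ i, r i * f (z i) := by
  obtain ⟨c, hanti, hc⟩ := hf
  have hlt : ∀ i, v i < 0 → f (z i + v i) - f (z i) < c a * v i := by
    intro i hi
    obtain ⟨h1, h2⟩ := hneg i hi
    have := (hc (z i) (h1 ▸ ha)).2 (z i + v i) h2 (by linarith)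
    rw [add_sub_cancel_left, h1] at this
    rwa [h1]
  have hle : ∀ i, f (z i + v i) - f (z i) ≤ c a * v i := by
    intro i
    rcases lt_trichotomy (v i) 0 with h | h | h
    · exact (hlt i h).le
    · simp [h]
    · have h1 := hpos i h
      have h2 := (hc (z i) (by linarith)).2 (z i + v i) (by linarith) (by linarith)
      rw [add_sub_cancel_left] at h2
      exact h2.le.trans (mul_le_mul_of_nonneg_right
        (hanti (mem_Ioi.2 ha) (mem_Ioi.2 (by linarith)) h1) h.le)
  obtain ⟨i₀, hi₀⟩ := hex
  rw [← sub_neg, ← Finset.sum_sub_distrib]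
  calc ∑ i, (r i * f (z i + v i) - r i * f (z i)) < ∑ i, c a * (r i * v i) := by
        refine Finset.sum_lt_sum (fun i _ => ?_) ⟨i₀, Finset.mem_univ _, ?_⟩
        · nlinarith [hr i, hle i]
        · nlinarith [hr i₀, hlt i₀ hi₀]
    _ = c a * ∑ i, r i * v i := by rw [Finset.mul_sum]
    _ ≤ 0 := mul_nonpos_of_nonneg_of_nonpos (hc a ha).1 hsum

theorem RegularKernel.sumTrans_eq_coe (hK : RegularKernel K) {y : Fin n → ℝ} {t : ℝ}
    (hJt : J t ≠ ⊤) (hJb : J t ≠ ⊥) (hy : ∀ i, K (t - y i) ≠ ⊥) :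
    SumTrans K J r y t = (((J t).toReal + ∑ i, r i * (K (t - y i)).toReal : ℝ) : EReal) := by
  rw [EReal.coe_add, EReal.coe_toReal hJt hJb, EReal.coe_sum]
  refine congrArg (J t + ·) (Finset.sum_congr rfl fun i _ => ?_)
  rw [EReal.coe_mul, EReal.coe_toReal (hK.ne_top _) (hy i)]

/-- Moving nodes along `v` strictly decreases the sum of translates at `t` when the nodes moving
towards `t` are at distance `a`, the ones moving away from `t` are at distance at least `a`,
all on the same side of `t`, and the former carry at least as much weighted displacement. -/
theorem RegularKernel.eventually_sumTrans_lt (hK : RegularKernel K) (hr : ∀ j, 0 < r j)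
    {σ : ℝ} (hσ : σ * σ = 1) (hf : HasStrictSupergradient fun z => (K (σ * z)).toReal)
    {w v : Fin n → ℝ} {t a : ℝ} (hJ : J t ≠ ⊤) (hw : SumTrans K J r w t ≠ ⊥) (ha : 0 < a)
    (hpos : ∀ i, 0 < σ * v i → σ * (t - w i) = a) (hneg : ∀ i, σ * v i < 0 → a ≤ σ * (t - w i))
    (hex : ∃ i, 0 < σ * v i) (hsum : 0 ≤ ∑ i, r i * (σ * v i)) :
    ∀ᶠ δ : ℝ in 𝓝[>] 0, SumTrans K J r (fun i => w i + δ * v i) t < SumTrans K J r w t := by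
  obtain ⟨hJb, hwb⟩ := EReal.add_ne_bot_iff.1 hw
  have hwb' : ∀ i, K (t - w i) ≠ ⊥ := fun i =>
    (EReal.coe_mul_ne_bot (hr i)).1 ((EReal.sum_ne_bot _).1 hwb i (Finset.mem_univ _))
  have hsmall : ∀ᶠ δ : ℝ in 𝓝[>] 0, ∀ i, δ * (σ * v i) < a :=
    eventually_all.2 fun i => nhdsWithin_le_nhds <|
      (Continuous.tendsto' (by fun_prop) (0 : ℝ) 0 (by simp) :
        Tendsto (fun δ : ℝ => δ * (σ * v i)) (𝓝 0) (𝓝 0)).eventually (eventually_lt_nhds ha)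
  filter_upwards [hsmall, self_mem_nhdsWithin] with δ hδ hδ0
  have hδ0 : 0 < δ := hδ0
  have hcancel : ∀ x : ℝ, σ * (σ * x) = x := fun x => by rw [← mul_assoc, hσ, one_mul]
  have hpos_of : ∀ i, δ * (σ * v i) > 0 → 0 < σ * v i := fun i h => pos_of_mul_pos_right h hδ0.le
  have hneg_of : ∀ i, δ * (σ * v i) < 0 → σ * v i < 0 := fun i h => by
    by_contra! h'
    exact absurd (mul_nonneg hδ0.le h') (not_le.2 h)
  have hdist : ∀ i, σ * (t - (w i + δ * v i)) = σ * (t - w i) + -(δ * (σ * v i)) :=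
    fun i => by ring
  have hyb : ∀ i, K (t - (w i + δ * v i)) ≠ ⊥ := by
    intro i
    rcases lt_trichotomy (σ * v i) 0 with h | h | h
    · have h1 := hneg i h
      refine hK.ne_bot _ fun h0 => ?_
      have h2 := hdist i
      rw [h0, mul_zero] at h2
      have := mul_neg_of_pos_of_neg hδ0 h
      linarith
    · have : v i = 0 := by rw [← hcancel (v i), h, mul_zero]
      simpa [this] using hwb' i
    · have h1 := hpos i h
      refine hK.ne_bot _ fun h0 => ?_
      have h2 := hdist i
      rw [h0, mul_zero] at h2
      linarith [hδ i]
  rw [hK.sumTrans_eq_coe hJ hJb hyb, hK.sumTrans_eq_coe hJ hJb hwb', EReal.coe_lt_coe_iff]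
  have key := hf.sum_lt hr (z := fun i => σ * (t - w i)) (v := fun i => -(δ * (σ * v i))) ha
    (fun i h => by
      have h1 := hpos i (hpos_of i (neg_lt_zero.1 h))
      exact ⟨h1, by linarith [hδ i]⟩)
    (fun i h => hneg i (hneg_of i (neg_pos.1 h)))
    (by
      obtain ⟨i, hi⟩ := hex
      exact ⟨i, neg_lt_zero.2 (mul_pos hδ0 hi)⟩)
    (by
      have : ∑ i, r i * -(δ * (σ * v i)) = -(δ * ∑ i, r i * (σ * v i)) := by
        rw [Finset.mul_sum, ← Finset.sum_neg_distrib]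
        exact Finset.sum_congr rfl fun i _ => by ring
      rw [this]
      exact neg_nonpos.2 (mul_nonneg hδ0.le hsum))
  simp only [← hdist, hcancel] at key
  linarith

/-- At a minimizer of the discretized maximum, every cell contains a point where the maximum is
attained. -/
theorem RegularKernel.exists_mem_cell_eq (hK : RegularKernel K)
    (hr : ∀ j, 0 < r j) (hright : HasStrictSupergradient fun z => (K (1 * z)).toReal)
    (hleft : HasStrictSupergradient fun z => (K (-1 * z)).toReal) {b : ℝ} {T : Finset ℝ}
    (hT : ∀ t ∈ T, 0 ≤ t ∧ t ≤ b) (hJ : ∀ t ∈ T, J t ≠ ⊤) {w : Fin n → ℝ}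
    (hw : w ∈ nodesIn n b) {μ : EReal} (hμ : μ ≠ ⊥) (hwμ : ∀ t ∈ T, SumTrans K J r w t ≤ μ)
    (hmin : ∀ y ∈ nodesIn n b, ∃ t ∈ T, μ ≤ SumTrans K J r y t) (j : Fin (n + 1)) :
    ∃ t ∈ T, t ∈ cell w j ∧ SumTrans K J r w t = μ := by
  classical
  by_contra! hno
  let L : Finset (Fin n) := Finset.univ.filter fun i =>
    (i : ℕ) < j ∧ ∀ i' : Fin n, (i' : ℕ) < j → w i' ≤ w i
  let R : Finset (Fin n) := Finset.univ.filter fun i =>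
    (j : ℕ) ≤ i ∧ ∀ i' : Fin n, (j : ℕ) ≤ i' → w i ≤ w i'
  have hL : ∀ i, i ∈ L ↔ (i : ℕ) < j ∧ ∀ i' : Fin n, (i' : ℕ) < j → w i' ≤ w i := by simp [L]
  have hR : ∀ i, i ∈ R ↔ (j : ℕ) ≤ i ∧ ∀ i' : Fin n, (j : ℕ) ≤ i' → w i ≤ w i' := by simp [R]
  have hLR : Disjoint L R := Finset.disjoint_left.2 fun i h1 h2 =>
    absurd ((hL i).1 h1).1 (not_lt.2 ((hR i).1 h2).1)
  let LA : Prop := ∃ t ∈ T, SumTrans K J r w t = μ ∧ ∃ i : Fin n, (i : ℕ) < j ∧ t < w i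
  let RA : Prop := ∃ t ∈ T, SumTrans K J r w t = μ ∧ ∃ i : Fin n, (j : ℕ) ≤ i ∧ w i < t
  let U : ℝ := if LA then (∑ i ∈ L, r i)⁻¹ else 0
  let V : ℝ := if RA then (∑ i ∈ R, r i)⁻¹ else 0
  have hLne : (∃ i : Fin n, (i : ℕ) < j) → L.Nonempty := by
    rintro ⟨i, hi⟩
    obtain ⟨i₁, h1, h2⟩ := Finset.exists_max_image
      (Finset.univ.filter fun i : Fin n => (i : ℕ) < j) w ⟨i, by simpa using hi⟩
    exact ⟨i₁, (hL i₁).2 ⟨by simpa using h1, fun i' hi' => h2 i' (by simpa using hi')⟩⟩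
  have hRne : (∃ i : Fin n, (j : ℕ) ≤ i) → R.Nonempty := by
    rintro ⟨i, hi⟩
    obtain ⟨i₁, h1, h2⟩ := Finset.exists_min_image
      (Finset.univ.filter fun i : Fin n => (j : ℕ) ≤ i) w ⟨i, by simpa using hi⟩
    exact ⟨i₁, (hR i₁).2 ⟨by simpa using h1, fun i' hi' => h2 i' (by simpa using hi')⟩⟩
  have hUpos : LA → 0 < U ∧ (∑ i ∈ L, r i) * U = 1 := by
    intro h
    have h' := h
    obtain ⟨t, -, -, i, hi, -⟩ := h'
    have hp : 0 < ∑ i ∈ L, r i := Finset.sum_pos (fun i _ => hr i) (hLne ⟨i, hi⟩)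
    simp only [U, if_pos h]
    exact ⟨inv_pos.2 hp, mul_inv_cancel₀ hp.ne'⟩
  have hVpos : RA → 0 < V ∧ (∑ i ∈ R, r i) * V = 1 := by
    intro h
    have h' := h
    obtain ⟨t, -, -, i, hi, -⟩ := h'
    have hp : 0 < ∑ i ∈ R, r i := Finset.sum_pos (fun i _ => hr i) (hRne ⟨i, hi⟩)
    simp only [V, if_pos h]
    exact ⟨inv_pos.2 hp, mul_inv_cancel₀ hp.ne'⟩
  have hU0 : ¬LA → U = 0 := fun h => if_neg h
  have hV0 : ¬RA → V = 0 := fun h => if_neg h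
  have hUnn : 0 ≤ U := by
    by_cases h : LA
    · exact (hUpos h).1.le
    · exact (hU0 h).ge
  have hVnn : 0 ≤ V := by
    by_cases h : RA
    · exact (hVpos h).1.le
    · exact (hV0 h).ge
  have hU1 : (∑ i ∈ L, r i) * U ≤ 1 := by
    by_cases h : LA
    · exact (hUpos h).2.le
    · simp [hU0 h]
  have hV1 : (∑ i ∈ R, r i) * V ≤ 1 := by
    by_cases h : RA
    · exact (hVpos h).2.le
    · simp [hV0 h]
  let v : Fin n → ℝ := fun i => if i ∈ L then -U else if i ∈ R then V else 0
  have hvL : ∀ i ∈ L, v i = -U := fun i hi => if_pos hi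
  have hvR : ∀ i ∈ R, v i = V := fun i hi => by
    simp [v, Finset.disjoint_right.1 hLR hi, hi]
  have hvneg : ∀ i, v i < 0 → i ∈ L ∧ LA := by
    intro i hi
    by_cases h : i ∈ L
    · refine ⟨h, by_contra fun hn => ?_⟩
      rw [hvL i h, hU0 hn] at hi
      simp at hi
    · simp only [v, if_neg h] at hi
      split_ifs at hi <;> linarith
  have hvpos : ∀ i, 0 < v i → i ∈ R ∧ RA := by
    intro i hi
    by_cases h : i ∈ L
    · rw [hvL i h] at hi
      linarith
    · by_cases h' : i ∈ R
      · refine ⟨h', by_contra fun hn => ?_⟩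
        rw [hvR i h', hV0 hn] at hi
        exact lt_irrefl _ hi
      · simp [v, h, h'] at hi
  have hvsum : ∑ i, r i * v i = (∑ i ∈ R, r i) * V - (∑ i ∈ L, r i) * U := by
    have : ∀ i, r i * v i = (if i ∈ R then r i * V else 0) - (if i ∈ L then r i * U else 0) := by
      intro i
      by_cases h : i ∈ L
      · simp [hvL i h, h, Finset.disjoint_left.1 hLR h]
      · by_cases h' : i ∈ R <;> simp [v, h, h']
    simp only [this, Finset.sum_sub_distrib, Finset.sum_ite_mem, Finset.univ_inter,
      Finset.sum_mul]
  have hvmono : ∀ i i', i ≤ i' → w i = w i' → v i ≤ v i' := by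
    intro i i' hii hww
    have hii' : (i : ℕ) ≤ i' := hii
    by_cases h : i ∈ L
    · rw [hvL i h]
      by_cases h' : i' ∈ L
      · rw [hvL i' h']
      · simp only [v, if_neg h']
        split_ifs <;> linarith
    · by_cases h' : i' ∈ L
      · exact absurd ((hL i).2 ⟨hii'.trans_lt ((hL i').1 h').1,
          fun k hk => hww ▸ ((hL i').1 h').2 k hk⟩) h
      · by_cases h2 : i ∈ R
        · have h3 : i' ∈ R := (hR i').2 ⟨((hR i).1 h2).1.trans hii',
            fun k hk => hww ▸ ((hR i).1 h2).2 k hk⟩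
          rw [hvR i h2, hvR i' h3]
        · simp only [v, if_neg h, if_neg h', if_neg h2]
          split_ifs <;> linarith
  have hcont : ∀ i, Continuous fun δ : ℝ => w i + δ * v i := fun i => by fun_prop
  have hat0 : ∀ i, Tendsto (fun δ : ℝ => w i + δ * v i) (𝓝[>] 0) (𝓝 (w i)) := fun i =>
    ((hcont i).tendsto' 0 _ (by simp)).mono_left nhdsWithin_le_nhds
  have hmem : ∀ᶠ δ : ℝ in 𝓝[>] 0, (fun i => w i + δ * v i) ∈ nodesIn n b := by
    have h1 : ∀ᶠ δ : ℝ in 𝓝[>] 0, ∀ i i', i ≤ i' → w i + δ * v i ≤ w i' + δ * v i' := by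
      refine eventually_all.2 fun i => eventually_all.2 fun i' => eventually_imp_distrib_left.2
        fun hii => ?_
      rcases (hw.1 hii).eq_or_lt with h | h
      · filter_upwards [self_mem_nhdsWithin] with δ hδ
        rw [h]
        exact add_le_add_right (mul_le_mul_of_nonneg_left (hvmono i i' hii h)
          (mem_Ioi.1 hδ).le) _
      · exact ((hat0 i).eventually_lt (hat0 i') h).mono fun δ h => h.le
    have h2 : ∀ᶠ δ : ℝ in 𝓝[>] 0, ∀ i, 0 ≤ w i + δ * v i := by
      refine eventually_all.2 fun i => ?_
      rcases lt_or_ge (v i) 0 with h | h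
      · obtain ⟨hiL, t, ht, -, i', hi', hti'⟩ := hvneg i h
        have : 0 < w i :=
          ((hT t ht).1.trans_lt hti').trans_le (((hL i).1 hiL).2 i' hi')
        exact ((hat0 i).eventually_const_lt this).mono fun δ h => h.le
      · filter_upwards [self_mem_nhdsWithin] with δ hδ
        exact add_nonneg (hw.2 i).1 (mul_nonneg (mem_Ioi.1 hδ).le h)
    have h3 : ∀ᶠ δ : ℝ in 𝓝[>] 0, ∀ i, w i + δ * v i ≤ b := by
      refine eventually_all.2 fun i => ?_
      rcases lt_or_ge 0 (v i) with h | h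
      · obtain ⟨hiR, t, ht, -, i', hi', hti'⟩ := hvpos i h
        have : w i < b := (((hR i).1 hiR).2 i' hi').trans_lt (hti'.trans_le (hT t ht).2)
        exact ((hat0 i).eventually_lt_const this).mono fun δ h => h.le
      · filter_upwards [self_mem_nhdsWithin] with δ hδ
        have := mul_nonpos_of_nonneg_of_nonpos (mem_Ioi.1 hδ).le h
        linarith [(hw.2 i).2]
    filter_upwards [h1, h2, h3] with δ h1 h2 h3
    exact ⟨fun i i' h => h1 i i' h, fun i => ⟨h2 i, h3 i⟩⟩
  have hlt : ∀ t ∈ T, ∀ᶠ δ : ℝ in 𝓝[>] 0, SumTrans K J r (fun i => w i + δ * v i) t < μ := by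
    intro t ht
    rcases (hwμ t ht).lt_or_eq with h | h
    · have hc : Continuous fun δ : ℝ => SumTrans K J r (fun i => w i + δ * v i) t :=
        (hK.continuous_sumTrans hr (hJ t ht)).comp (continuous_pi hcont)
      have h0 : Tendsto (fun δ : ℝ => SumTrans K J r (fun i => w i + δ * v i) t) (𝓝[>] 0)
          (𝓝 (SumTrans K J r w t)) :=
        (hc.tendsto' 0 _ (by simp)).mono_left nhdsWithin_le_nhds
      exact h0.eventually_lt_const h
    · have hcell : t ∉ cell w j := fun hc => hno t ht hc h
      have hcell' : (∃ i : Fin n, (i : ℕ) < j ∧ t < w i) ∨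
          ∃ i : Fin n, (j : ℕ) ≤ i ∧ w i < t := by
        by_contra! hh
        exact hcell ⟨hh.1, hh.2⟩
      rw [← h]
      rcases hcell' with ⟨i, hi, hti⟩ | ⟨i, hi, hti⟩
      · have hLA : LA := ⟨t, ht, h, i, hi, hti⟩
        obtain ⟨i₁, hi₁⟩ := hLne ⟨i, hi⟩
        have hti₁ : t < w i₁ := hti.trans_le (((hL i₁).1 hi₁).2 i hi)
        refine hK.eventually_sumTrans_lt hr (σ := -1) (by norm_num) hleft (hJ t ht) (h ▸ hμ)
          (a := w i₁ - t) (sub_pos.2 hti₁) (fun k hk => ?_) (fun k hk => ?_) ⟨i₁, ?_⟩ ?_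
        · have hkL := (hvneg k (by linarith)).1
          have h1 := ((hL k).1 hkL).2 i₁ ((hL i₁).1 hi₁).1
          have h2 := ((hL i₁).1 hi₁).2 k ((hL k).1 hkL).1
          linarith
        · have hkR := (hvpos k (by linarith)).1
          have h1 : w i₁ ≤ w k :=
            hw.1 (Fin.le_def.2 (((hL i₁).1 hi₁).1.le.trans ((hR k).1 hkR).1))
          linarith
        · rw [hvL i₁ hi₁]
          linarith [(hUpos hLA).1]
        · have : ∑ k, r k * (-1 * v k) = -∑ k, r k * v k := by
            rw [← Finset.sum_neg_distrib]
            exact Finset.sum_congr rfl fun k _ => by ring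
          rw [this, hvsum, (hUpos hLA).2]
          linarith
      · have hRA : RA := ⟨t, ht, h, i, hi, hti⟩
        obtain ⟨i₁, hi₁⟩ := hRne ⟨i, hi⟩
        have hti₁ : w i₁ < t := (((hR i₁).1 hi₁).2 i hi).trans_lt hti
        refine hK.eventually_sumTrans_lt hr (σ := 1) (by norm_num) hright (hJ t ht) (h ▸ hμ)
          (a := t - w i₁) (sub_pos.2 hti₁) (fun k hk => ?_) (fun k hk => ?_) ⟨i₁, ?_⟩ ?_
        · have hkR := (hvpos k (by linarith)).1
          have h1 := ((hR k).1 hkR).2 i₁ ((hR i₁).1 hi₁).1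
          have h2 := ((hR i₁).1 hi₁).2 k ((hR k).1 hkR).1
          linarith
        · have hkL := (hvneg k (by linarith)).1
          have h1 : w k ≤ w i₁ :=
            hw.1 (Fin.le_def.2 (((hL k).1 hkL).1.le.trans ((hR i₁).1 hi₁).1))
          linarith
        · rw [hvR i₁ hi₁]
          linarith [(hVpos hRA).1]
        · simp only [one_mul]
          rw [hvsum, (hVpos hRA).2]
          linarith
  obtain ⟨δ, hδ, hδT⟩ := (hmem.and ((Finset.eventually_all T).2 hlt)).exists
  obtain ⟨t, ht, hle⟩ := hmin _ hδ
  exact absurd (hδT t ht) (not_lt.2 hle)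

theorem HasStrictSupergradient.hasSupergradient {f : ℝ → ℝ} (hf : HasStrictSupergradient f) :
    HasSupergradient f := by
  obtain ⟨c, hanti, hc⟩ := hf
  refine ⟨c, hanti, fun a ha => ⟨(hc a ha).1, fun z hz => ?_⟩⟩
  rcases eq_or_ne z a with rfl | h
  · simp
  · exact ((hc a ha).2 z hz h).le

theorem HasSupergradient.add_sqrt {f g : ℝ → ℝ} (hf : HasSupergradient f) {ε : ℝ} (hε : 0 < ε)
    (hg : ∀ z, 0 < z → g z = f z + ε * √z) : HasStrictSupergradient g := by
  obtain ⟨c, hanti, hc⟩ := hf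
  refine ⟨fun a => c a + ε * (1 / (2 * √a)), fun a ha b hb hab => ?_, fun a ha =>
    ⟨add_nonneg (hc a ha).1 (by positivity), fun z hz hza => ?_⟩⟩
  · have : 0 < √a := Real.sqrt_pos.2 ha
    have h1 := hanti ha hb hab
    dsimp only
    gcongr
  · have h1 := (hc a ha).2 z hz
    have ha' : 0 < √a := Real.sqrt_pos.2 ha
    have hsa := Real.sq_sqrt ha.le
    have hsz := Real.sq_sqrt hz.le
    have hne : √z - √a ≠ 0 := sub_ne_zero.2 fun h => hza ((Real.sqrt_inj hz.le ha.le).1 h)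
    have h2 : √z - √a < 1 / (2 * √a) * (z - a) := by
      rw [one_div, inv_mul_eq_div, lt_div_iff₀ (by positivity)]
      nlinarith [sq_pos_of_ne_zero hne]
    rw [hg z hz, hg a ha]
    nlinarith [mul_lt_mul_of_pos_left h2 hε]

/-- The kernel `K` made strictly concave by adding `ε * √|x|`. -/
def addSqrt (K : ℝ → EReal) (ε x : ℝ) : EReal :=
  K x + ((ε * √|x| : ℝ) : EReal)

theorem RegularKernel.toReal_addSqrt (hK : RegularKernel K) (ε : ℝ) {x : ℝ} (hx : x ≠ 0) :
    (addSqrt K ε x).toReal = (K x).toReal + ε * √|x| :=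
  EReal.toReal_add (hK.ne_top x) (hK.ne_bot x hx) (EReal.coe_ne_top _) (EReal.coe_ne_bot _)

theorem RegularKernel.addSqrt_right (hK : RegularKernel K) {ε : ℝ} (hε : 0 < ε) :
    HasStrictSupergradient fun z => (addSqrt K ε z).toReal :=
  hK.right.add_sqrt hε fun z hz => by rw [hK.toReal_addSqrt ε hz.ne', abs_of_pos hz]

theorem RegularKernel.addSqrt_left (hK : RegularKernel K) {ε : ℝ} (hε : 0 < ε) :
    HasStrictSupergradient fun z => (addSqrt K ε (-z)).toReal :=
  hK.left.add_sqrt hε fun z hz => by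
    rw [hK.toReal_addSqrt ε (neg_ne_zero.2 hz.ne'), abs_neg, abs_of_pos hz]

theorem RegularKernel.addSqrt (hK : RegularKernel K) {ε : ℝ} (hε : 0 < ε) :
    RegularKernel (addSqrt K ε) where
  continuous := EReal.continuous_add_of_ne_top hK.continuous
    (continuous_coe_real_ereal.comp (by fun_prop)) hK.ne_top fun _ => EReal.coe_ne_top _
  ne_top x := EReal.add_ne_top (hK.ne_top x) (EReal.coe_ne_top _)
  ne_bot x hx := EReal.add_ne_bot_iff.2 ⟨hK.ne_bot x hx, EReal.coe_ne_bot _⟩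
  right := (hK.addSqrt_right hε).hasSupergradient
  left := (hK.addSqrt_left hε).hasSupergradient

theorem sumTrans_addSqrt (hr : ∀ j, 0 < r j) (ε : ℝ) (y : Fin n → ℝ) (t : ℝ) :
    SumTrans (addSqrt K ε) J r y t =
      SumTrans K J r y t + ((ε * ∑ j, r j * √|t - y j| : ℝ) : EReal) := by
  have h : ∀ j, (r j : EReal) * addSqrt K ε (t - y j) =
      r j * K (t - y j) + ((ε * (r j * √|t - y j|) : ℝ) : EReal) := by
    intro j
    rw [addSqrt, EReal.left_distrib_of_nonneg_of_ne_top (EReal.coe_nonneg.2 (hr j).le)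
      (EReal.coe_ne_top _), ← EReal.coe_mul]
    congr 2
    ring
  simp only [SumTrans, h, Finset.sum_add_distrib, ← EReal.coe_sum, ← Finset.mul_sum, add_assoc]

theorem sumTrans_le_sumTrans_addSqrt (hr : ∀ j, 0 < r j) {ε : ℝ} (hε : 0 ≤ ε) (y : Fin n → ℝ)
    (t : ℝ) : SumTrans K J r y t ≤ SumTrans (addSqrt K ε) J r y t := by
  rw [sumTrans_addSqrt hr]
  refine le_add_of_nonneg_right (EReal.coe_nonneg.2 (mul_nonneg hε ?_))
  exact Finset.sum_nonneg fun j _ => mul_nonneg (hr j).le (Real.sqrt_nonneg _)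

theorem sumTrans_addSqrt_le (hr : ∀ j, 0 < r j) {ε : ℝ} (hε : 0 ≤ ε) {b : ℝ} {y : Fin n → ℝ}
    (hy : y ∈ nodesIn n b) {t : ℝ} (ht : t ∈ Icc 0 b) :
    SumTrans (addSqrt K ε) J r y t ≤
      SumTrans K J r y t + ((ε * ((∑ j, r j) * √b) : ℝ) : EReal) := by
  rw [sumTrans_addSqrt hr]
  refine add_le_add_right (EReal.coe_le_coe_iff.2 (mul_le_mul_of_nonneg_left ?_ hε)) _
  rw [Finset.sum_mul]
  refine Finset.sum_le_sum fun j _ => mul_le_mul_of_nonneg_left (Real.sqrt_le_sqrt ?_) (hr j).le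
  have := hy.2 j
  exact abs_le.2 ⟨by linarith [ht.1], by linarith [ht.2]⟩

/-- A strict lower bound for all `⨆ j, mlocHalf K J r y j` is already witnessed by finitely many
points of `[0,b]`. -/
theorem MonotoneKernel.exists_finset_lt_sumTrans (hK : MonotoneKernel K) (hr : ∀ j, 0 < r j)
    (hJ : ∀ t, 0 ≤ t → J t ≠ ⊤) (hadm : IsAdmissibleHalf K J (∑ j, r j)) {α : EReal}
    (hα : α ≠ ⊥)
    (hlt : ∀ y : Fin n → ℝ, Monotone y → (∀ j, 0 ≤ y j) → α < ⨆ j, mlocHalf K J r y j) :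
    ∃ b : ℝ, 0 ≤ b ∧ ∃ T : Finset ℝ, (∀ t ∈ T, t ∈ Icc 0 b) ∧
      ∀ y ∈ nodesIn n b, ∃ t ∈ T, α < SumTrans K J r y t := by
  obtain ⟨b, hb0, hb⟩ := hK.exists_sumTrans_lt hr hadm hα
  obtain ⟨T, hT⟩ := (isCompact_nodesIn (n := n) b).elim_finite_subcover
    (fun t : Icc (0 : ℝ) b => {y | α < SumTrans K J r y t})
    (fun t => isOpen_lt continuous_const
      (hK.regularKernel.continuous_sumTrans hr (hJ t t.2.1))) fun y hy => by
    obtain ⟨t, ht0, ht⟩ : ∃ t, 0 ≤ t ∧ α < SumTrans K J r y t := by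
      by_contra! h
      exact absurd (iSup_mlocHalf_le h) (not_le.2 (hlt y hy.1 fun j => (hy.2 j).1))
    have htb : t ≤ b := not_lt.1 fun h => (hb y hy t h).not_gt ht
    exact mem_iUnion.2 ⟨⟨t, ht0, htb⟩, ht⟩
  refine ⟨b, hb0, T.map (Function.Embedding.subtype _), fun t ht => ?_, fun y hy => ?_⟩
  · obtain ⟨s, -, rfl⟩ := Finset.mem_map.1 ht
    exact s.2
  · obtain ⟨t, ht, h⟩ := mem_iUnion₂.1 (hT hy)
    exact ⟨t, Finset.mem_map_of_mem _ ht, h⟩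

theorem MonotoneKernel.exists_le_iInf_mlocHalf (hK : MonotoneKernel K) (hr : ∀ j, 0 < r j)
    (hJ : ∀ t, 0 ≤ t → J t ≠ ⊤) (hadm : IsAdmissibleHalf K J (∑ j, r j)) {α β : ℝ} (hαβ : α < β)
    (hlt : ∀ y : Fin n → ℝ, Monotone y → (∀ j, 0 ≤ y j) →
      (β : EReal) < ⨆ j, mlocHalf K J r y j) :
    ∃ w : Fin n → ℝ, Monotone w ∧ (∀ j, 0 ≤ w j) ∧ (α : EReal) ≤ ⨅ j, mlocHalf K J r w j := by
  obtain ⟨b, hb0, T, hTb, hT⟩ :=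
    hK.exists_finset_lt_sumTrans hr hJ hadm (EReal.coe_ne_bot β) hlt
  obtain ⟨ε, hε, hεαβ⟩ : ∃ ε : ℝ, 0 < ε ∧ ε * ((∑ j, r j) * √b) ≤ β - α := by
    have hR : 0 ≤ (∑ j, r j) * √b :=
      mul_nonneg (Finset.sum_nonneg fun j _ => (hr j).le) (Real.sqrt_nonneg b)
    refine ⟨(β - α) / ((∑ j, r j) * √b + 1), div_pos (by linarith) (by linarith), ?_⟩
    rw [div_mul_eq_mul_div, div_le_iff₀ (by linarith)]
    nlinarith
  have hK' := hK.regularKernel.addSqrt hε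
  have hTne : T.Nonempty := by
    obtain ⟨t, ht, -⟩ := hT _ (nodesIn_nonempty hb0).some_mem
    exact ⟨t, ht⟩
  have hlsc : LowerSemicontinuous fun y : Fin n → ℝ =>
      ⨆ t : T, SumTrans (addSqrt K ε) J r y t :=
    lowerSemicontinuous_iSup fun t =>
      (hK'.continuous_sumTrans hr (hJ t (hTb t t.2).1)).lowerSemicontinuous
  obtain ⟨w, hw, hmin⟩ := (hlsc.lowerSemicontinuousOn _).exists_isMinOn (nodesIn_nonempty hb0)
    (isCompact_nodesIn (n := n) b)
  set μ : EReal := ⨆ t : T, SumTrans (addSqrt K ε) J r w t with hμ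
  have hβμ : (β : EReal) < μ := by
    obtain ⟨t, ht, h⟩ := hT w hw
    exact h.trans_le ((sumTrans_le_sumTrans_addSqrt hr hε.le w t).trans
      (le_iSup (fun t : T => SumTrans (addSqrt K ε) J r w t) ⟨t, ht⟩))
  have : Nonempty T := hTne.to_subtype
  refine ⟨w, hw.1, fun j => (hw.2 j).1, le_iInf fun j => ?_⟩
  obtain ⟨t, ht, htj, h⟩ := hK'.exists_mem_cell_eq hr
    (by simpa only [one_mul] using hK.regularKernel.addSqrt_right hε)
    (by simpa only [neg_one_mul] using hK.regularKernel.addSqrt_left hε)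
    (fun t ht => hTb t ht) (fun t ht => hJ t (hTb t ht).1) hw hβμ.ne_bot
    (fun t ht => le_iSup (fun t : T => SumTrans (addSqrt K ε) J r w t) ⟨t, ht⟩)
    (fun y hy => by
      obtain ⟨t, ht⟩ := exists_eq_ciSup_of_finite
        (f := fun t : T => SumTrans (addSqrt K ε) J r y t)
      exact ⟨t, t.2, (isMinOn_iff.1 hmin y hy).trans ht.ge⟩) j
  refine le_trans ?_ (le_sSup (mem_image_of_mem _ (mem_inter htj (mem_Ici.2 (hTb t ht).1))))
  have h1 : (β : EReal) ≤ SumTrans K J r w t + ((β - α : ℝ) : EReal) :=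
    hβμ.le.trans (h.ge.trans ((sumTrans_addSqrt_le hr hε.le hw (hTb t ht)).trans
      (add_le_add_right (EReal.coe_le_coe_iff.2 hεαβ) _)))
  refine (EReal.addLECancellable_coe (β - α)).add_le_add_iff_right.1 ?_
  refine le_trans (le_of_eq ?_) h1
  rw [← EReal.coe_add, add_sub_cancel]

end Translates

/-- Problems on a semiaxis: for a monotone kernel `K` and an
`R`-admissible `n`-field `J⁺` on `[0,∞)`:
`M(S^{[0,∞)}) = m(S^{[0,∞)})`; the minimax is attained at some `w ∈ S^{[0,∞)}`;
and any equioscillation point `e` on `[0,∞)` satisfies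
`M(S^{[0,∞)}) = m̄⁺(e) = m̲⁺(e) = m(S^{[0,∞)})`. -/
theorem semiaxis_minimax_maximin (K J : ℝ → EReal) (hK : MonotoneKernel K)
    (n : ℕ) (hn : 0 < n) (r : Fin n → ℝ) (hr : ∀ j, 0 < r j)
    (hJ : IsFieldFnHalf n J) (hadm : IsAdmissibleHalf K J (∑ j, r j)) :
    (sInf ((fun y : Fin n → ℝ => ⨆ j : Fin (n + 1), mlocHalf K J r y j) ''
        {y | Monotone y ∧ ∀ j, 0 ≤ y j}) =
      sSup ((fun y : Fin n → ℝ => ⨅ j : Fin (n + 1), mlocHalf K J r y j) ''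
        {y | Monotone y ∧ ∀ j, 0 ≤ y j})) ∧
    (∃ w : Fin n → ℝ, Monotone w ∧ (∀ j, 0 ≤ w j) ∧
      (⨆ j : Fin (n + 1), mlocHalf K J r w j) =
        sInf ((fun y : Fin n → ℝ => ⨆ j : Fin (n + 1), mlocHalf K J r y j) ''
          {y | Monotone y ∧ ∀ j, 0 ≤ y j})) ∧
    (∀ e : Fin n → ℝ, Monotone e → (∀ j, 0 ≤ e j) →
      (∀ j j' : Fin (n + 1), mlocHalf K J r e j = mlocHalf K J r e j') →
      (⨆ j : Fin (n + 1), mlocHalf K J r e j) =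
          sInf ((fun y : Fin n → ℝ => ⨆ j : Fin (n + 1), mlocHalf K J r y j) ''
            {y | Monotone y ∧ ∀ j, 0 ≤ y j}) ∧
      (⨆ j : Fin (n + 1), mlocHalf K J r e j) = (⨅ j : Fin (n + 1), mlocHalf K J r e j) ∧
      (⨅ j : Fin (n + 1), mlocHalf K J r e j) =
          sSup ((fun y : Fin n → ℝ => ⨅ j : Fin (n + 1), mlocHalf K J r y j) ''
            {y | Monotone y ∧ ∀ j, 0 ≤ y j})) := by
  have hJt : ∀ t, 0 ≤ t → J t ≠ ⊤ := by
    obtain ⟨c, hc⟩ := hJ.1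
    exact fun t ht => ne_top_of_le_ne_top (EReal.coe_ne_top c) (hc t ht)
  have hR := hK.regularKernel
  have hle : ∀ x y : Fin n → ℝ, Monotone y →
      ⨅ j, mlocHalf K J r x j ≤ ⨆ j, mlocHalf K J r y j :=
    fun x y hy => hR.iInf_mlocHalf_le_iSup hr hy
  set S : Set (Fin n → ℝ) := {y | Monotone y ∧ ∀ j, 0 ≤ y j}
  set M := sInf ((fun y : Fin n → ℝ => ⨆ j : Fin (n + 1), mlocHalf K J r y j) '' S)
  set m := sSup ((fun y : Fin n → ℝ => ⨅ j : Fin (n + 1), mlocHalf K J r y j) '' S)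
  have hM : ∀ y ∈ S, M ≤ ⨆ j, mlocHalf K J r y j := fun y hy => sInf_le ⟨y, hy, rfl⟩
  have hm : ∀ y ∈ S, ⨅ j, mlocHalf K J r y j ≤ m := fun y hy => le_sSup ⟨y, hy, rfl⟩
  have hmM : m ≤ M := by
    refine sSup_le ?_
    rintro _ ⟨x, -, rfl⟩
    refine le_sInf ?_
    rintro _ ⟨y, hy, rfl⟩
    exact hle x y hy.1
  have hMm : M ≤ m := by
    refine le_of_forall_lt fun a ha => ?_
    obtain ⟨α, haα, hα⟩ := EReal.lt_iff_exists_real_btwn.1 ha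
    obtain ⟨β, hαβ, hβ⟩ := EReal.lt_iff_exists_real_btwn.1 hα
    obtain ⟨w, hw, hw0, h⟩ := hK.exists_le_iInf_mlocHalf hr hJt hadm
      (EReal.coe_lt_coe_iff.1 hαβ) fun y hy hy0 => hβ.trans_le (hM y ⟨hy, hy0⟩)
    exact haα.trans_le (h.trans (hm w ⟨hw, hw0⟩))
  have hMeq : M = m := hMm.antisymm hmM
  refine ⟨hMeq, ?_, fun e he he0 heq => ?_⟩
  · obtain ⟨x, -, -, hx⟩ := hR.exists_iInf_mlocHalf_ne_bot hr hJ.2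
    obtain ⟨w, hw, hw0, hmin⟩ := hK.exists_iSup_mlocHalf_le hr hJt hadm hx
      fun y hy _ => hle x y hy
    refine ⟨w, hw, hw0, le_antisymm (le_sInf ?_) (hM w ⟨hw, hw0⟩)⟩
    rintro _ ⟨y, hy, rfl⟩
    exact hmin y hy.1 hy.2
  · have h : ⨆ j, mlocHalf K J r e j = ⨅ j, mlocHalf K J r e j := by
      simp only [heq _ 0, iSup_const, iInf_const]
    have h1 := hM e ⟨he, he0⟩
    have h2 := hm e ⟨he, he0⟩
    have h3 : ⨆ j, mlocHalf K J r e j = M := le_antisymm (h.trans_le (h2.trans hmM)) h1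
    exact ⟨h3, h, by rw [← h, h3, hMeq]⟩
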